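/- Let X and Y be nonempty finite prompt sets, 𝒜 and 𝒟 nonempty finite action sets, γ̃_A : X → Δ(𝒜) and γ̃_D : Y → Δ(𝒟) the LLM-induced policy maps, and u_A, u_D : 𝒜 × 𝒟 → ℝ payoff functions. Define U_A(x,y) = E_{a∼γ̃_A(x), d∼γ̃_D(y)}[u_A(a,d)] and U_D(x,y) = E_{a∼γ̃_A(x), d∼γ̃_D(y)}[u_D(a,d)]. If (σ_A*, σ_D*) is a mixed-strategy reasoning equilibrium of the prompt game with payoffs (U_A, U_D), then the induced behavioral strategies μ_A* = Σ_{x∈X} σ_A*(x)·γ̃_A(x) ∈ Δ(𝒜) and μ_D* = Σ_{y∈Y} σ_D*(y)·γ̃_D(y) ∈ Δ(𝒟) form a Nash equilibrium of the behavioral game restricted to the convex hulls of the induced policy sets: for every μ_A in the convex hull of {γ̃_A(x) : x ∈ X}, E_{a∼μ_A*, d∼μ_D*}[u_A(a,d)] ≥ E_{a∼μ_A, d∼μ_D*}[u_A(a,d)], and symmetrically for player D with u_D over the convex hull of {γ̃_D(y) : y ∈ Y}. -/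

import Mathlib

theorem payoff_expand {X Y A D : Type*} [Fintype X] [Fintype Y] [Fintype A] [Fintype D]
    (f : X → A → ℝ) (g : Y → D → ℝ) (u : A × D → ℝ) (s : X → ℝ) (t : Y → ℝ) :
    ∑ a, ∑ d, (∑ x, s x * f x a) * (∑ y, t y * g y d) * u (a, d) =
      ∑ x, ∑ y, s x * t y * (∑ a, ∑ d, f x a * g y d * u (a, d)) := by
  have h1 : ∀ a d, (∑ x, s x * f x a) * (∑ y, t y * g y d) * u (a, d) =
      ∑ x, ∑ y, s x * t y * (f x a * g y d * u (a, d)) := by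
    intro a d
    rw [Finset.sum_mul_sum, Finset.sum_mul]
    refine Finset.sum_congr rfl fun x _ => ?_
    rw [Finset.sum_mul]
    exact Finset.sum_congr rfl fun y _ => by ring
  simp_rw [h1, Finset.mul_sum]
  calc _ = ∑ a, ∑ x, ∑ d, ∑ y, s x * t y * (f x a * g y d * u (a, d)) :=
        Finset.sum_congr rfl fun a _ => Finset.sum_comm
    _ = ∑ x, ∑ a, ∑ d, ∑ y, s x * t y * (f x a * g y d * u (a, d)) := Finset.sum_comm
    _ = ∑ x, ∑ a, ∑ y, ∑ d, s x * t y * (f x a * g y d * u (a, d)) :=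
        Finset.sum_congr rfl fun x _ => Finset.sum_congr rfl fun a _ => Finset.sum_comm
    _ = _ := Finset.sum_congr rfl fun x _ => Finset.sum_comm

theorem hull_weights {X A : Type*} [Fintype X] (f : X → A → ℝ) (m : A → ℝ)
    (hm : m ∈ convexHull ℝ (Set.range f)) :
    ∃ s : X → ℝ, (∀ x, 0 ≤ s x) ∧ (∑ x, s x) = 1 ∧ m = fun a => ∑ x, s x * f x a := by
  classical
  refine convexHull_min (t := {m | ∃ s : X → ℝ, (∀ x, 0 ≤ s x) ∧ (∑ x, s x) = 1 ∧
    m = fun a => ∑ x, s x * f x a}) ?_ ?_ hm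
  · rintro _ ⟨x, rfl⟩
    refine ⟨fun z => if z = x then 1 else 0, fun z => ?_, by simp, by simp⟩
    dsimp only
    split_ifs <;> norm_num
  · rintro _ ⟨s, hs0, hs1, rfl⟩ _ ⟨t, ht0, ht1, rfl⟩ a b ha hb hab
    refine ⟨fun z => a * s z + b * t z, fun z => ?_, ?_, ?_⟩
    · exact add_nonneg (mul_nonneg ha (hs0 z)) (mul_nonneg hb (ht0 z))
    · rw [Finset.sum_add_distrib, ← Finset.mul_sum, ← Finset.mul_sum, hs1, ht1]
      linarith
    · funext c
      simp only [Pi.add_apply, Pi.smul_apply, smul_eq_mul, Finset.mul_sum]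
      rw [← Finset.sum_add_distrib]
      exact Finset.sum_congr rfl fun y _ => by ring

/-- A mixed-strategy reasoning equilibrium `(σA, σD)` of the prompt game with
payoffs `U_A(x,y) = E[u_A]`, `U_D(x,y) = E[u_D]` induces behavioral strategies
`μA* = ∑ x, σA x • γA x` and `μD* = ∑ y, σD y • γD y` that form a Nash
equilibrium of the behavioral game restricted to the convex hulls of the
induced policy sets. -/
theorem reasoning_equilibrium_induces_behavioral_equilibrium
    {X Y A D : Type*} [Fintype X] [Fintype Y] [Fintype A] [Fintype D]
    [Nonempty X] [Nonempty Y] [Nonempty A] [Nonempty D]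
    (γA : X → A → ℝ) (γD : Y → D → ℝ)
    (hγA₀ : ∀ x a, 0 ≤ γA x a) (hγA₁ : ∀ x, (∑ a, γA x a) = 1)
    (hγD₀ : ∀ y d, 0 ≤ γD y d) (hγD₁ : ∀ y, (∑ d, γD y d) = 1)
    (uA uD : A × D → ℝ)
    (σA : X → ℝ) (σD : Y → ℝ)
    (hσA₀ : ∀ x, 0 ≤ σA x) (hσA₁ : (∑ x, σA x) = 1)
    (hσD₀ : ∀ y, 0 ≤ σD y) (hσD₁ : (∑ y, σD y) = 1)
    -- equilibrium in the prompt game with payoffs U_A, U_D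
    (heqA : ∀ σA' : X → ℝ, (∀ x, 0 ≤ σA' x) → (∑ x, σA' x) = 1 →
      ∑ x, ∑ y, σA' x * σD y * (∑ a, ∑ d, γA x a * γD y d * uA (a, d)) ≤
        ∑ x, ∑ y, σA x * σD y * (∑ a, ∑ d, γA x a * γD y d * uA (a, d)))
    (heqD : ∀ σD' : Y → ℝ, (∀ y, 0 ≤ σD' y) → (∑ y, σD' y) = 1 →
      ∑ x, ∑ y, σA x * σD' y * (∑ a, ∑ d, γA x a * γD y d * uD (a, d)) ≤
        ∑ x, ∑ y, σA x * σD y * (∑ a, ∑ d, γA x a * γD y d * uD (a, d))) :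
    -- the induced behavioral strategies
    (∀ μA ∈ convexHull ℝ (Set.range γA),
      ∑ a, ∑ d, μA a * (∑ y, σD y * γD y d) * uA (a, d) ≤
        ∑ a, ∑ d, (∑ x, σA x * γA x a) * (∑ y, σD y * γD y d) * uA (a, d)) ∧
    (∀ μD ∈ convexHull ℝ (Set.range γD),
      ∑ a, ∑ d, (∑ x, σA x * γA x a) * μD d * uD (a, d) ≤
        ∑ a, ∑ d, (∑ x, σA x * γA x a) * (∑ y, σD y * γD y d) * uD (a, d)) := by
  constructor
  · intro μA hμ
    obtain ⟨s, h0, h1, rfl⟩ := hull_weights γA μA hμ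
    rw [payoff_expand, payoff_expand]
    exact heqA s h0 h1
  · intro μD hμ
    obtain ⟨s, h0, h1, rfl⟩ := hull_weights γD μD hμ
    rw [payoff_expand, payoff_expand]
    exact heqD s h0 h1
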